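/- arXiv:2406.02954 — 5 statements merged into one kernel-verified Lean document; each statement's English description precedes it below -/
import Mathlib

section
/- Let n ≥ 1 be an integer, let ζ ∈ ℂ be a primitive nth root of unity, let a ∈ ℂ with a ≠ 0 and a^n ≠ 1, and let ℓ1, ℓ2 ≥ 0 be integers. Then F_n(a,ζ;ℓ1,ℓ2) · F_n(1/a,ζ;ℓ1,ℓ2) · (∑_{j=0}^{n-1} a^j)^4 = n^4 · a^{2(n-1)} · F_n(1,ζ;ℓ1,ℓ2)². (Equivalently, F_n(a,ζ)F_n(1/a,ζ)/F_n(1,ζ)² = (n a^{(n-1)/2}/(1+a+⋯+a^{n-1}))^4, independent of the choice of primitive nth root of unity.) -/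
open Finset

/-- The q-Pochhammer symbol `(x;q)_k = ∏_{j=0}^{k-1} (1 - x q^j)`. -/
noncomputable def qPoch (x q : ℂ) (k : ℕ) : ℂ := ∏ j ∈ Finset.range k, (1 - x * q ^ j)

/-- The summand `f_k(a,q;ℓ1,ℓ2)`. -/
noncomputable def f (a q : ℂ) (l1 l2 : ℤ) (k : ℕ) : ℂ :=
  qPoch (q ^ l1 * a) q k * qPoch (q ^ (1 - l1) * a) q k *
    qPoch (q ^ l2 * a) q k * qPoch (q ^ (1 - l2) * a) q k * q ^ k /
    (qPoch (q * a) q k) ^ 4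

/-- The truncated sum `F_n(a,q;ℓ1,ℓ2)`. -/
noncomputable def F (n : ℕ) (a q : ℂ) (l1 l2 : ℤ) : ℂ :=
  ∑ k ∈ Finset.range n, f a q l1 l2 k

open Polynomial in
/-- For `p` of degree below `2n - 1`, summing `q p(a q)` over the powers `q` of a primitive
`n`-th root of unity extracts the coefficient of degree `n - 1`. -/
lemma sum_pow_mul_eval_primitiveRoot {N : ℕ} {ζ : ℂ} (hζ : IsPrimitiveRoot ζ (N + 1))
    {p : ℂ[X]} (hp : p.natDegree ≤ 2 * N) (a : ℂ) :
    ∑ k ∈ range (N + 1), ζ ^ k * p.eval (a * ζ ^ k) = (N + 1) * p.coeff N * a ^ N := by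
  have hp' : p.natDegree < 2 * N + 1 := by omega
  have h1 : ∀ k, ζ ^ k * p.eval (a * ζ ^ k) =
      ∑ i ∈ range (2 * N + 1), p.coeff i * a ^ i * (ζ ^ (i + 1)) ^ k := by
    intro k
    rw [eval_eq_sum_range' hp', mul_sum]
    refine sum_congr rfl fun i _ => ?_
    rw [mul_pow, ← pow_mul, ← pow_mul, add_mul, pow_add, mul_comm i k]
    ring
  simp only [h1]
  rw [sum_comm, sum_eq_single N]
  · simp [hζ.pow_eq_one]
    ring
  · intro i hi hne
    rw [← mul_sum]
    have hz : ζ ^ (i + 1) ≠ 1 := by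
      rw [Ne, hζ.pow_eq_one_iff_dvd]
      rintro ⟨c, hc⟩
      have hi' := mem_range.1 hi
      rcases c with _ | _ | c
      · omega
      · omega
      · have : (N + 1) * (c + 1 + 1) = (N + 1) * c + 2 * (N + 1) := by ring
        omega
    have h0 : (∑ k ∈ range (N + 1), (ζ ^ (i + 1)) ^ k) * (ζ ^ (i + 1) - 1) = 0 := by
      rw [geom_sum_mul, ← pow_mul, mul_comm, pow_mul, hζ.pow_eq_one, one_pow, sub_self]
    rw [(mul_eq_zero.1 h0).resolve_right (sub_ne_zero.2 hz), mul_zero]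
  · intro h
    exact absurd (mem_range.2 (by omega)) h

lemma qPoch_add (x q : ℂ) (m k : ℕ) :
    qPoch x q (m + k) = qPoch x q m * qPoch (q ^ m * x) q k := by
  simp only [qPoch, prod_range_add]
  congr 1
  refine prod_congr rfl fun j _ => ?_
  ring

lemma qPoch_shift_mul (x q : ℂ) (m k : ℕ) :
    qPoch (q ^ m * x) q k * qPoch x q m = qPoch (q ^ k * x) q m * qPoch x q k := by
  rw [mul_comm, ← qPoch_add, add_comm, qPoch_add, mul_comm]

lemma qPoch_ne_zero {N : ℕ} {ζ a : ℂ} (hζ : IsPrimitiveRoot ζ (N + 1))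
    (ha : a = 1 ∨ a ^ (N + 1) ≠ 1) {m : ℕ} (hm : m ≤ N) : qPoch (ζ * a) ζ m ≠ 0 := by
  refine prod_ne_zero_iff.2 fun j hj h => ?_
  have hj := mem_range.1 hj
  have h1 : a * ζ ^ (j + 1) = 1 := by linear_combination -h
  rcases ha with rfl | ha
  · exact hζ.pow_ne_one_of_pos_of_lt (by omega) (by omega) ((one_mul _).symm.trans h1)
  · apply ha
    have := congrArg (· ^ (N + 1)) h1
    simpa [mul_pow, ← pow_mul, mul_comm (j + 1), pow_mul ζ (N + 1), hζ.pow_eq_one] using this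

open Polynomial in
lemma prod_sub_primitiveRoot_pow {N : ℕ} {ζ : ℂ} (hζ : IsPrimitiveRoot ζ (N + 1)) (a : ℂ) :
    ∏ k ∈ range N, (a - ζ ^ (k + 1)) = ∑ i ∈ range (N + 1), a ^ i := by
  have h := X_pow_sub_C_eq_prod hζ N.zero_lt_succ (one_pow (N + 1))
  rw [C_1, ← mul_geom_sum, prod_range_succ', pow_zero, mul_one, mul_comm, eq_comm] at h
  replace h := congrArg (Polynomial.eval a) (mul_right_cancel₀ (X_sub_C_ne_zero 1) h)
  simpa [eval_prod, eval_finsetSum] using h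

/-- The reflection formula for `q`-Pochhammer symbols of complementary lengths. -/
lemma pow_mul_qPoch_mul_qPoch_inv {N m m' : ℕ} (hm : m + m' = N) {ζ a : ℂ}
    (hζ : IsPrimitiveRoot ζ (N + 1)) (ha : a ≠ 0) :
    a ^ m' * qPoch (ζ * a) ζ m * qPoch (ζ * a⁻¹) ζ m' =
      (∏ i ∈ range m, -ζ ^ (i + 1)) * ∑ i ∈ range (N + 1), a ^ i := by
  have h1 : a ^ m' * qPoch (ζ * a⁻¹) ζ m' = ∏ i ∈ range m', (a - ζ ^ (i + 1)) := by
    rw [qPoch, pow_eq_prod_const, ← prod_mul_distrib]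
    refine prod_congr rfl fun i _ => ?_
    field_simp
    ring
  have h2 : qPoch (ζ * a) ζ m = (∏ i ∈ range m, -ζ ^ (i + 1)) *
      ∏ i ∈ range m, (a - ζ ^ (m' + i + 1)) := by
    rw [← prod_range_reflect (fun i => a - ζ ^ (m' + i + 1)), qPoch, ← prod_mul_distrib]
    refine prod_congr rfl fun i hi => ?_
    have hi := mem_range.1 hi
    have h3 : ζ ^ (i + 1) * ζ ^ (m' + (m - 1 - i) + 1) = 1 := by
      rw [← pow_add, show i + 1 + (m' + (m - 1 - i) + 1) = N + 1 by omega, hζ.pow_eq_one]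
    linear_combination -h3
  rw [← prod_sub_primitiveRoot_pow hζ, ← hm, add_comm m m', prod_range_add, ← h1, h2]
  ring

lemma exists_zpow_eq {N : ℕ} {ζ : ℂ} (hζ : IsPrimitiveRoot ζ (N + 1)) (l : ℕ) :
    ∃ m m' : ℕ, m + m' = N ∧ ζ ^ (l : ℤ) = ζ ^ m * ζ ∧ ζ ^ (1 - (l : ℤ)) = ζ ^ m' * ζ := by
  have hlt := Nat.mod_lt (l + N) N.succ_pos
  have hdiv := Nat.mod_add_div (l + N) (N + 1)
  have h0 : ζ ≠ 0 := hζ.ne_zero (by omega)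
  set m := (l + N) % (N + 1)
  set t := (l + N) / (N + 1)
  refine ⟨m, N - m, by omega, ?_, ?_⟩
  · have h : ζ ^ l * ζ ^ (N + 1) = ζ ^ m * ζ * (ζ ^ (N + 1)) ^ t := by
      rw [← pow_mul, ← pow_add, ← pow_succ, ← pow_add]
      congr 1
      omega
    simpa [hζ.pow_eq_one] using h
  · have h : ζ ^ (N - m) * ζ ^ l = 1 := by
      have h' : N - m + l + (N + 1) = (N + 1) * (t + 1) := by
        rw [mul_add, mul_one]
        omega
      rw [← pow_add, ← mul_one (ζ ^ _), ← hζ.pow_eq_one, ← pow_add, h', pow_mul,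
        hζ.pow_eq_one, one_pow]
    rw [zpow_sub₀ h0, zpow_one, zpow_natCast, div_eq_iff (pow_ne_zero _ h0)]
    linear_combination -ζ * h

open Polynomial in
/-- `qPoch (ζ * x) ζ m` as a polynomial in `x`. -/
noncomputable def qPochPoly (ζ : ℂ) (m : ℕ) : ℂ[X] :=
  ∏ j ∈ range m, (1 - C (ζ ^ (j + 1)) * X)

lemma eval_qPochPoly (ζ x : ℂ) (m : ℕ) :
    (qPochPoly ζ m).eval x = qPoch (ζ * x) ζ m := by
  simp only [qPochPoly, qPoch, Polynomial.eval_prod]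
  refine prod_congr rfl fun j _ => ?_
  simp
  ring

lemma natDegree_qPochPoly_le (ζ : ℂ) (m : ℕ) : (qPochPoly ζ m).natDegree ≤ m := by
  refine (Polynomial.natDegree_prod_le _ _).trans ?_
  refine (sum_le_card_nsmul _ _ 1 fun j _ => ?_).trans (by simp)
  compute_degree

/-- Up to an explicit product of `q`-Pochhammer symbols, `F` at a root of unity is a monomial. -/
lemma exists_F_mul_qPoch_eq {N m₁ m₁' m₂ m₂' : ℕ} (h₁ : m₁ + m₁' = N) (h₂ : m₂ + m₂' = N)
    {ζ : ℂ} (hζ : IsPrimitiveRoot ζ (N + 1)) {l1 l2 : ℤ}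
    (e₁ : ζ ^ l1 = ζ ^ m₁ * ζ) (e₁' : ζ ^ (1 - l1) = ζ ^ m₁' * ζ)
    (e₂ : ζ ^ l2 = ζ ^ m₂ * ζ) (e₂' : ζ ^ (1 - l2) = ζ ^ m₂' * ζ) :
    ∃ r : ℂ, ∀ a : ℂ, (a = 1 ∨ a ^ (N + 1) ≠ 1) →
      F (N + 1) a ζ l1 l2 * ((qPoch (ζ * a) ζ m₁ * qPoch (ζ * a) ζ m₁') *
        (qPoch (ζ * a) ζ m₂ * qPoch (ζ * a) ζ m₂')) = r * a ^ N := by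
  set p := qPochPoly ζ m₁ * qPochPoly ζ m₁' * (qPochPoly ζ m₂ * qPochPoly ζ m₂') with hp
  have hdeg : p.natDegree ≤ 2 * N := by
    have hd := natDegree_qPochPoly_le ζ
    refine (Polynomial.natDegree_mul_le_of_le
      (Polynomial.natDegree_mul_le_of_le (hd m₁) (hd m₁'))
      (Polynomial.natDegree_mul_le_of_le (hd m₂) (hd m₂'))).trans ?_
    omega
  refine ⟨(N + 1) * p.coeff N, fun a ha => ?_⟩
  rw [← sum_pow_mul_eval_primitiveRoot hζ hdeg, F, sum_mul]
  refine sum_congr rfl fun k hk => ?_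
  have hk0 := qPoch_ne_zero hζ ha (Nat.lt_succ_iff.1 (mem_range.1 hk))
  have hs := fun m => qPoch_shift_mul (ζ * a) ζ m k
  rw [f, e₁, e₁', e₂, e₂', div_mul_eq_mul_div, div_eq_iff (pow_ne_zero 4 hk0), hp]
  simp only [Polynomial.eval_mul, eval_qPochPoly]
  simp only [mul_assoc (ζ ^ _) ζ a, show ζ * (a * ζ ^ k) = ζ ^ k * (ζ * a) by ring]
  calc _ = ζ ^ k * ((qPoch (ζ ^ m₁ * (ζ * a)) ζ k * qPoch (ζ * a) ζ m₁) *
        (qPoch (ζ ^ m₁' * (ζ * a)) ζ k * qPoch (ζ * a) ζ m₁') *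
        (qPoch (ζ ^ m₂ * (ζ * a)) ζ k * qPoch (ζ * a) ζ m₂) *
        (qPoch (ζ ^ m₂' * (ζ * a)) ζ k * qPoch (ζ * a) ζ m₂')) := by ring
    _ = _ := by
      rw [hs, hs, hs, hs]
      ring

lemma qPoch_reflection {N m m' : ℕ} (hm : m + m' = N) {ζ a : ℂ}
    (hζ : IsPrimitiveRoot ζ (N + 1)) (ha : a ≠ 0) :
    (qPoch (ζ * 1) ζ m * qPoch (ζ * 1) ζ m') ^ 2 * (∑ i ∈ range (N + 1), a ^ i) ^ 2 =
      (N + 1) ^ 2 * a ^ N * ((qPoch (ζ * a) ζ m * qPoch (ζ * a) ζ m') *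
        (qPoch (ζ * a⁻¹) ζ m * qPoch (ζ * a⁻¹) ζ m')) := by
  have hm' : m' + m = N := by omega
  have A := pow_mul_qPoch_mul_qPoch_inv hm hζ ha
  have A' := pow_mul_qPoch_mul_qPoch_inv hm' hζ ha
  have B := pow_mul_qPoch_mul_qPoch_inv hm hζ one_ne_zero
  have B' := pow_mul_qPoch_mul_qPoch_inv hm' hζ one_ne_zero
  simp only [one_pow, one_mul, inv_one, sum_const, card_range, nsmul_eq_mul, mul_one,
    Nat.cast_add, Nat.cast_one] at B B' ⊢
  set S := ∑ i ∈ range (N + 1), a ^ i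
  set c := ∏ i ∈ range m, -ζ ^ (i + 1)
  set c' := ∏ i ∈ range m', -ζ ^ (i + 1)
  calc _ = (qPoch ζ ζ m * qPoch ζ ζ m') * (qPoch ζ ζ m' * qPoch ζ ζ m) * S ^ 2 := by ring
    _ = (N + 1) ^ 2 * ((c * S) * (c' * S)) := by
      rw [B, B']
      ring
    _ = _ := by
      rw [← A, ← A', ← hm, pow_add]
      ring

theorem stmt_1 (n : ℕ) (hn : 1 ≤ n) (ζ : ℂ) (hζ : IsPrimitiveRoot ζ n)
    (a : ℂ) (ha0 : a ≠ 0) (ha : a ^ n ≠ 1) (l1 l2 : ℕ) :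
    F n a ζ l1 l2 * F n (1 / a) ζ l1 l2 * (∑ j ∈ Finset.range n, a ^ j) ^ 4 =
      (n : ℂ) ^ 4 * a ^ (2 * (n - 1)) * (F n 1 ζ l1 l2) ^ 2 := by
  obtain ⟨N, rfl⟩ : ∃ N, n = N + 1 := ⟨n - 1, by omega⟩
  obtain ⟨m₁, m₁', h₁, e₁, e₁'⟩ := exists_zpow_eq hζ l1
  obtain ⟨m₂, m₂', h₂, e₂, e₂'⟩ := exists_zpow_eq hζ l2
  obtain ⟨r, hr⟩ := exists_F_mul_qPoch_eq h₁ h₂ hζ e₁ e₁' e₂ e₂'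
  have ha' : a⁻¹ ^ (N + 1) ≠ 1 := by simpa [inv_pow] using ha
  have hF := hr a (.inr ha)
  have hF' := hr a⁻¹ (.inr ha')
  have hF1 := hr 1 (.inl rfl)
  have R₁ := qPoch_reflection h₁ hζ ha0
  have R₂ := qPoch_reflection h₂ hζ ha0
  have ne : ∀ {b : ℂ}, (b = 1 ∨ b ^ (N + 1) ≠ 1) →
      (qPoch (ζ * b) ζ m₁ * qPoch (ζ * b) ζ m₁') *
        (qPoch (ζ * b) ζ m₂ * qPoch (ζ * b) ζ m₂') ≠ 0 := fun hb =>
    mul_ne_zero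
      (mul_ne_zero (qPoch_ne_zero hζ hb (by omega)) (qPoch_ne_zero hζ hb (by omega)))
      (mul_ne_zero (qPoch_ne_zero hζ hb (by omega)) (qPoch_ne_zero hζ hb (by omega)))
  have na := ne (.inr ha)
  have na' := ne (.inr ha')
  have n1 := ne (.inl rfl)
  rw [one_div, Nat.add_sub_cancel]
  generalize hS : ∑ i ∈ range (N + 1), a ^ i = S at *
  generalize qPoch (ζ * a) ζ m₁ * qPoch (ζ * a) ζ m₁' = P₁ at *
  generalize qPoch (ζ * a) ζ m₂ * qPoch (ζ * a) ζ m₂' = P₂ at *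
  generalize qPoch (ζ * a⁻¹) ζ m₁ * qPoch (ζ * a⁻¹) ζ m₁' = Q₁ at *
  generalize qPoch (ζ * a⁻¹) ζ m₂ * qPoch (ζ * a⁻¹) ζ m₂' = Q₂ at *
  generalize qPoch (ζ * 1) ζ m₁ * qPoch (ζ * 1) ζ m₁' = T₁ at *
  generalize qPoch (ζ * 1) ζ m₂ * qPoch (ζ * 1) ζ m₂' = T₂ at *
  have hinv : a ^ N * a⁻¹ ^ N = 1 := by rw [← mul_pow, mul_inv_cancel₀ ha0, one_pow]
  refine mul_right_cancel₀ (mul_ne_zero (mul_ne_zero na na') (pow_ne_zero 2 n1)) ?_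
  push_cast
  rw [one_pow, mul_one] at hF1
  calc _ = (F (N + 1) a ζ l1 l2 * (P₁ * P₂)) * (F (N + 1) a⁻¹ ζ l1 l2 * (Q₁ * Q₂)) *
        ((T₁ ^ 2 * S ^ 2) * (T₂ ^ 2 * S ^ 2)) := by ring
    _ = (a ^ N * a⁻¹ ^ N) * r ^ 2 * (N + 1) ^ 4 * a ^ (2 * N) * (P₁ * P₂ * (Q₁ * Q₂)) := by
      rw [hF, hF', R₁, R₂]
      ring
    _ = (N + 1) ^ 4 * a ^ (2 * N) * (F (N + 1) 1 ζ l1 l2 * (T₁ * T₂)) ^ 2 *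
        (P₁ * P₂ * (Q₁ * Q₂)) := by
      rw [hinv, hF1]
      ring
    _ = _ := by ring
end

section
/- Let a, q ∈ ℂ with q ≠ 0, let k ≥ 0 be an integer with (qa;q)_k ≠ 0, and let ℓ1, ℓ2 be integers. Then (q^{-ℓ2}-q^{-ℓ1})(1-q^{ℓ1}a)(1-q^{ℓ2}a)·f_k(a,q;ℓ1+1,ℓ2+1) + (q^{ℓ1}-q^{-ℓ2})(1-q^{-ℓ1}a)(1-q^{ℓ2}a)·f_k(a,q;ℓ1,ℓ2+1) + (q^{-ℓ1}-q^{ℓ2})(1-q^{ℓ1}a)(1-q^{-ℓ2}a)·f_k(a,q;ℓ1+1,ℓ2) + (q^{ℓ2}-q^{ℓ1})(1-q^{-ℓ1}a)(1-q^{-ℓ2}a)·f_k(a,q;ℓ1,ℓ2) = 0. -/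
open Finset

theorem one_sub_mul_qPoch_mul (x q : ℂ) (k : ℕ) :
    (1 - x) * qPoch (q * x) q k = qPoch x q k * (1 - x * q ^ k) := by
  unfold qPoch
  rw [← Finset.prod_range_succ (fun j => 1 - x * q ^ j), Finset.prod_range_succ']
  simp only [pow_zero, mul_one, pow_succ]
  rw [mul_comm]
  congr 1
  exact Finset.prod_congr rfl fun j _ => by ring

theorem stmt_2 (a q : ℂ) (hq : q ≠ 0) (k : ℕ) (hk : qPoch (q * a) q k ≠ 0)
    (l1 l2 : ℤ) :
    (q ^ (-l2) - q ^ (-l1)) * (1 - q ^ l1 * a) * (1 - q ^ l2 * a) *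
        f a q (l1 + 1) (l2 + 1) k +
      (q ^ l1 - q ^ (-l2)) * (1 - q ^ (-l1) * a) * (1 - q ^ l2 * a) *
        f a q l1 (l2 + 1) k +
      (q ^ (-l1) - q ^ l2) * (1 - q ^ l1 * a) * (1 - q ^ (-l2) * a) *
        f a q (l1 + 1) l2 k +
      (q ^ l2 - q ^ l1) * (1 - q ^ (-l1) * a) * (1 - q ^ (-l2) * a) *
        f a q l1 l2 k = 0 := by
  have shift (l : ℤ) :
      (1 - q ^ l * a) * qPoch (q ^ (l + 1) * a) q k =
        qPoch (q ^ l * a) q k * (1 - q ^ l * a * q ^ k) := by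
    rw [← one_sub_mul_qPoch_mul, zpow_add_one₀ hq, mul_comm (q ^ l) q, mul_assoc q]
  have raise (l : ℤ) :
      (1 - q ^ l * a) * (qPoch (q ^ (l + 1) * a) q k * qPoch (q ^ (1 - (l + 1)) * a) q k) =
        qPoch (q ^ l * a) q k * qPoch (q ^ (-l) * a) q k * (1 - q ^ l * a * q ^ k) := by
    rw [← mul_assoc, shift, show 1 - (l + 1) = -l by ring]
    ring
  have keep (l : ℤ) :
      (1 - q ^ (-l) * a) * (qPoch (q ^ l * a) q k * qPoch (q ^ (1 - l) * a) q k) =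
        qPoch (q ^ l * a) q k * qPoch (q ^ (-l) * a) q k * (1 - q ^ (-l) * a * q ^ k) := by
    rw [mul_left_comm, show 1 - l = -l + 1 by ring, shift]
    ring
  have factor (c u v A B C D : ℂ) :
      c * u * v * (A * B * C * D * q ^ k / qPoch (q * a) q k ^ 4) =
        c * (u * (A * B)) * (v * (C * D)) * (q ^ k / qPoch (q * a) q k ^ 4) := by
    ring
  have hx : q ^ l1 * q ^ (-l1) = 1 := by rw [← zpow_add₀ hq]; simp
  have hy : q ^ l2 * q ^ (-l2) = 1 := by rw [← zpow_add₀ hq]; simp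
  simp only [f, factor, raise, keep]
  generalize q ^ l1 = x at *
  generalize q ^ (-l1) = x' at *
  generalize q ^ l2 = y at *
  generalize q ^ (-l2) = y' at *
  have cancel (t : ℂ) :
      (y' - x') * (1 - x * t) * (1 - y * t) + (x - y') * (1 - x' * t) * (1 - y * t) +
        (x' - y) * (1 - x * t) * (1 - y' * t) + (y - x) * (1 - x' * t) * (1 - y' * t) = 0 := by
    grind
  linear_combination qPoch (x * a) q k * qPoch (x' * a) q k *
    (qPoch (y * a) q k * qPoch (y' * a) q k) * (q ^ k / qPoch (q * a) q k ^ 4) *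
    cancel (a * q ^ k)
end

section
/- Let n ≥ 1 be an integer, let a, q ∈ ℂ with q ≠ 0, with 1 - q^j ≠ 0 for j = 1, …, n-1, and with 1 - q^j a ≠ 0 for j = 0, 1, …, max(ℓ1,ℓ2)+1, where ℓ1, ℓ2 ≥ 0 are integers. Writing Φ(ℓ1,ℓ2) = G(a,q;ℓ1,ℓ2)·F_n(1,q;ℓ1,ℓ2), one has (q^{-ℓ2}-q^{-ℓ1})(1-q^{ℓ1}a)(1-q^{ℓ2}a)·Φ(ℓ1+1,ℓ2+1) + (q^{ℓ1}-q^{-ℓ2})(1-q^{-ℓ1}a)(1-q^{ℓ2}a)·Φ(ℓ1,ℓ2+1) + (q^{-ℓ1}-q^{ℓ2})(1-q^{ℓ1}a)(1-q^{-ℓ2}a)·Φ(ℓ1+1,ℓ2) + (q^{ℓ2}-q^{ℓ1})(1-q^{-ℓ1}a)(1-q^{-ℓ2}a)·Φ(ℓ1,ℓ2) = 0; that is, G(a,q;ℓ1,ℓ2)F_n(1,q;ℓ1,ℓ2) satisfies the same four-term recursion in (ℓ1,ℓ2) as F_n(a,q;ℓ1,ℓ2). -/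
open Finset

/-- The product `G(a,q;ℓ1,ℓ2)`. -/
noncomputable def G (a q : ℂ) (l1 l2 : ℕ) : ℂ :=
  ((∏ j ∈ Finset.range l1, (a - q ^ j)) * ∏ j ∈ Finset.range l2, (a - q ^ j)) /
    ((∏ j ∈ Finset.range l1, (1 - q ^ j * a)) * ∏ j ∈ Finset.range l2, (1 - q ^ j * a))

theorem qPoch_succ (x q : ℂ) (k : ℕ) : qPoch x q (k + 1) = qPoch x q k * (1 - x * q ^ k) :=
  Finset.prod_range_succ _ _

theorem qPoch_succ' (x q : ℂ) (k : ℕ) : qPoch x q (k + 1) = (1 - x) * qPoch (x * q) q k := by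
  simp only [qPoch, Finset.prod_range_succ', pow_succ', pow_zero, mul_one, mul_assoc]
  ring

/-- The four-term recursion for the numerators of `f` at `a = 1`, with `x = q ^ ℓ1`
and `y = q ^ ℓ2`. -/
theorem qPoch_four_term {x y : ℂ} (hx : x ≠ 0) (hy : y ≠ 0) (q : ℂ) (k : ℕ) :
    (x - y) *
        (qPoch (x * q) q k * qPoch x⁻¹ q k * qPoch (y * q) q k * qPoch y⁻¹ q k -
          qPoch x q k * qPoch (x⁻¹ * q) q k * qPoch y q k * qPoch (y⁻¹ * q) q k) +
      (1 - x * y) *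
        (qPoch x q k * qPoch (x⁻¹ * q) q k * qPoch (y * q) q k * qPoch y⁻¹ q k -
          qPoch (x * q) q k * qPoch x⁻¹ q k * qPoch y q k * qPoch (y⁻¹ * q) q k) = 0 := by
  cases k with
  | zero => simp [qPoch]
  | succ m =>
    rw [qPoch_succ (x * q), qPoch_succ (y * q), qPoch_succ (x⁻¹ * q), qPoch_succ (y⁻¹ * q),
      qPoch_succ' x, qPoch_succ' y, qPoch_succ' x⁻¹, qPoch_succ' y⁻¹]
    generalize qPoch (x * q) q m = A
    generalize qPoch (x⁻¹ * q) q m = B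
    generalize qPoch (y * q) q m = C
    generalize qPoch (y⁻¹ * q) q m = D
    field_simp
    ring

/-- The four-term recursion for `F` at `a = 1`. -/
theorem F_one_four_term {q : ℂ} (hq : q ≠ 0) (n : ℕ) (l1 l2 : ℤ) :
    (q ^ l1 - q ^ l2) * (F n 1 q (l1 + 1) (l2 + 1) - F n 1 q l1 l2) +
      (1 - q ^ l1 * q ^ l2) * (F n 1 q l1 (l2 + 1) - F n 1 q (l1 + 1) l2) = 0 := by
  simp only [F, ← Finset.sum_sub_distrib, Finset.mul_sum, ← Finset.sum_add_distrib]
  refine Finset.sum_eq_zero fun k _ => ?_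
  have shift (l : ℤ) : q ^ (1 - (l + 1)) = (q ^ l)⁻¹ := by
    rw [← zpow_neg]; congr 1; ring
  have refl (l : ℤ) : q ^ (1 - l) = (q ^ l)⁻¹ * q := by
    rw [zpow_sub₀ hq, zpow_one, div_eq_mul_inv, mul_comm]
  simp only [f, mul_one, shift, refl, zpow_add_one₀ hq]
  linear_combination (q ^ k / qPoch q q k ^ 4) *
    qPoch_four_term (zpow_ne_zero l1 hq) (zpow_ne_zero l2 hq) q k

theorem G_succ_left (a q : ℂ) (l1 l2 : ℕ) :
    G a q (l1 + 1) l2 = (a - q ^ l1) / (1 - q ^ l1 * a) * G a q l1 l2 := by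
  simp only [G, Finset.prod_range_succ, div_eq_mul_inv, mul_inv]
  ring

theorem G_succ_right (a q : ℂ) (l1 l2 : ℕ) :
    G a q l1 (l2 + 1) = (a - q ^ l2) / (1 - q ^ l2 * a) * G a q l1 l2 := by
  simp only [G, Finset.prod_range_succ, div_eq_mul_inv, mul_inv]
  ring

theorem stmt_4 (n : ℕ) (hn : 1 ≤ n) (a q : ℂ) (hq : q ≠ 0)
    (hq' : ∀ j : ℕ, 1 ≤ j → j ≤ n - 1 → (1 : ℂ) - q ^ j ≠ 0)
    (l1 l2 : ℕ)
    (ha : ∀ j : ℕ, j ≤ max l1 l2 + 1 → 1 - q ^ j * a ≠ 0) :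
    (q ^ (-(l2 : ℤ)) - q ^ (-(l1 : ℤ))) * (1 - q ^ (l1 : ℤ) * a) * (1 - q ^ (l2 : ℤ) * a) *
        (G a q (l1 + 1) (l2 + 1) * F n 1 q (l1 + 1) (l2 + 1)) +
      (q ^ (l1 : ℤ) - q ^ (-(l2 : ℤ))) * (1 - q ^ (-(l1 : ℤ)) * a) * (1 - q ^ (l2 : ℤ) * a) *
        (G a q l1 (l2 + 1) * F n 1 q l1 (l2 + 1)) +
      (q ^ (-(l1 : ℤ)) - q ^ (l2 : ℤ)) * (1 - q ^ (l1 : ℤ) * a) * (1 - q ^ (-(l2 : ℤ)) * a) *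
        (G a q (l1 + 1) l2 * F n 1 q (l1 + 1) l2) +
      (q ^ (l2 : ℤ) - q ^ (l1 : ℤ)) * (1 - q ^ (-(l1 : ℤ)) * a) * (1 - q ^ (-(l2 : ℤ)) * a) *
        (G a q l1 l2 * F n 1 q l1 l2) = 0 := by
  have h1 := ha l1 (by omega)
  have h2 := ha l2 (by omega)
  have hF := F_one_four_term hq n l1 l2
  have hx : q ^ l1 ≠ 0 := pow_ne_zero _ hq
  have hy : q ^ l2 ≠ 0 := pow_ne_zero _ hq
  simp only [G_succ_left, G_succ_right, zpow_neg, zpow_natCast] at hF ⊢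
  generalize q ^ l1 = x at *
  generalize q ^ l2 = y at *
  field_simp
  linear_combination (a - x) * (a - y) * G a q l1 l2 * hF
end

section
/- Let n ≥ 1 be an integer, let ζ ∈ ℂ be a primitive nth root of unity, let a ∈ ℂ with a^n ≠ 1, and let ℓ be an integer with 1 ≤ ℓ ≤ n. Then ∑_{k=0}^{n-1} (1-a)·(ζ^ℓ a;ζ)_k (ζ^{1-ℓ}a;ζ)_k · ζ^k / ((1-ζ^k a)·(ζa;ζ)_k²) = [n² a^{n-1} / (∑_{j=0}^{n-1} a^j)²] · ∏_{j=1}^{ℓ-1}(a-ζ^j) / ∏_{j=1}^{ℓ-1}(1-ζ^j a). -/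
open Finset

/-- The ratio `∏_{j=1}^{m} (1 - ζ^j x) / (1 - ζ^{-j} x)`. -/
noncomputable def reflRatio (ζ : ℂ) (m : ℕ) (x : ℂ) : ℂ :=
  ∏ j ∈ Finset.range m, (1 - ζ ^ ((j : ℤ) + 1) * x) / (1 - ζ ^ (-((j : ℤ) + 1)) * x)

lemma reflRatio_succ (ζ : ℂ) (m : ℕ) (x : ℂ) :
    reflRatio ζ (m + 1) x =
      reflRatio ζ m x * ((1 - ζ ^ ((m : ℤ) + 1) * x) / (1 - ζ ^ (-((m : ℤ) + 1)) * x)) :=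
  Finset.prod_range_succ _ _

lemma reflRatio_ne_zero {ζ x : ℂ} (hx : ∀ i : ℤ, 1 - ζ ^ i * x ≠ 0) (m : ℕ) :
    reflRatio ζ m x ≠ 0 :=
  Finset.prod_ne_zero_iff.2 fun _ _ => div_ne_zero (hx _) (hx _)

lemma one_sub_zpow_mul_ne_zero {ζ a : ℂ} {n : ℕ} (hζ : ζ ^ n = 1) (ha : a ^ n ≠ 1) (i : ℤ) :
    1 - ζ ^ i * a ≠ 0 := by
  intro h
  apply ha
  have h1 : (ζ ^ i * a) ^ n = 1 := by rw [← sub_eq_zero.1 h, one_pow]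
  rwa [mul_pow, ← zpow_natCast (ζ ^ i), zpow_comm, zpow_natCast, hζ, one_zpow, one_mul] at h1

lemma reflRatio_shift {ζ x : ℂ} (h0 : ζ ≠ 0) (hx : ∀ i : ℤ, 1 - ζ ^ i * x ≠ 0) (m : ℕ) :
    reflRatio ζ m (ζ * x) * ((1 - ζ * x) * (1 - x)) =
      reflRatio ζ m x * ((1 - ζ ^ ((m : ℤ) + 1) * x) * (1 - ζ ^ (-(m : ℤ)) * x)) := by
  induction m with
  | zero => simp [reflRatio]
  | succ m ih =>
    have e1 : ζ ^ ((m : ℤ) + 1) * (ζ * x) = ζ ^ ((m : ℤ) + 1 + 1) * x := by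
      rw [zpow_add_one₀ h0 ((m : ℤ) + 1)]; ring
    have e2 : ζ ^ (-((m : ℤ) + 1)) * (ζ * x) = ζ ^ (-(m : ℤ)) * x := by
      rw [show -(m : ℤ) = -((m : ℤ) + 1) + 1 by ring, zpow_add_one₀ h0]; ring
    rw [reflRatio_succ, reflRatio_succ, e1, e2, mul_right_comm, ih]
    have h1 := hx (-(m : ℤ))
    have h2 := hx (-((m : ℤ) + 1))
    push_cast
    generalize 1 - ζ ^ (-(m : ℤ)) * x = u at *
    generalize 1 - ζ ^ (-((m : ℤ) + 1)) * x = v at *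
    field_simp

/-- The product of `q`-Pochhammer symbols with parameters `ζ^(m+1) a` and `ζ^(-m) a`, relative to
`(ζ a; ζ)_k ^ 2`, is a ratio of values of `reflRatio`. -/
lemma qPoch_mul_qPoch_eq {ζ a : ℂ} (h0 : ζ ≠ 0) (hx : ∀ i : ℤ, 1 - ζ ^ i * a ≠ 0) (m k : ℕ) :
    qPoch (ζ ^ (m + 1) * a) ζ k * qPoch (ζ ^ (-(m : ℤ)) * a) ζ k * (1 - ζ ^ k * a) *
        reflRatio ζ m a =
      reflRatio ζ m (ζ ^ k * a) * (1 - a) * (qPoch (ζ * a) ζ k) ^ 2 := by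
  induction k with
  | zero => simp [qPoch]; ring
  | succ k ih =>
    have hs := reflRatio_shift (x := ζ ^ k * a) h0 (fun i => by
      rw [← mul_assoc, ← zpow_natCast ζ k, ← zpow_add₀ h0]; exact hx _) m
    have hk : 1 - ζ ^ k * a ≠ 0 := by simpa using hx k
    have hq (x : ℂ) : qPoch x ζ (k + 1) = qPoch x ζ k * (1 - x * ζ ^ k) :=
      Finset.prod_range_succ _ _
    rw [hq, hq, hq]
    have e1 : ζ ^ (k + 1) * a = ζ * (ζ ^ k * a) := by ring
    have e2 : ζ ^ ((m : ℤ) + 1) = ζ ^ (m + 1) := by exact_mod_cast zpow_natCast ζ (m + 1)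
    rw [e1]
    rw [e2] at hs
    apply mul_right_cancel₀ hk
    linear_combination (1 - ζ ^ (m + 1) * a * ζ ^ k) * (1 - ζ ^ (-(m : ℤ)) * a * ζ ^ k) *
      (1 - ζ * (ζ ^ k * a)) * ih -
      (1 - ζ * (ζ ^ k * a)) * (1 - a) * (qPoch (ζ * a) ζ k) ^ 2 * hs

lemma sum_pow_mul_geom_sq {ζ : ℂ} {n : ℕ} (hζ : IsPrimitiveRoot ζ n) (a : ℂ) :
    ∑ k ∈ Finset.range n, ζ ^ k * (∑ j ∈ Finset.range n, (ζ ^ k * a) ^ j) ^ 2 =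
      (n : ℂ) ^ 2 * a ^ (n - 1) := by
  have h1 : ∀ k, ζ ^ k * (∑ j ∈ Finset.range n, (ζ ^ k * a) ^ j) ^ 2 =
      ∑ i ∈ Finset.range n, ∑ j ∈ Finset.range n, a ^ (i + j) * (ζ ^ (i + j + 1)) ^ k := by
    intro k
    rw [sq, Finset.sum_mul_sum, Finset.mul_sum]
    refine Finset.sum_congr rfl fun i _ => ?_
    rw [Finset.mul_sum]
    refine Finset.sum_congr rfl fun j _ => ?_
    rw [← pow_mul, mul_comm (i + j + 1) k, pow_mul]
    ring
  simp_rw [h1]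
  rw [Finset.sum_comm]
  have h2 : ∀ i ∈ Finset.range n, ∑ k ∈ Finset.range n, ∑ j ∈ Finset.range n,
      a ^ (i + j) * (ζ ^ (i + j + 1)) ^ k = (n : ℂ) * a ^ (n - 1) := by
    intro i hi
    rw [Finset.mem_range] at hi
    rw [Finset.sum_comm, Finset.sum_eq_single (n - 1 - i)]
    · rw [show i + (n - 1 - i) + 1 = n by omega, show i + (n - 1 - i) = n - 1 by omega,
        hζ.pow_eq_one]
      simp
    · intro j hj hne
      rw [Finset.mem_range] at hj
      have hne1 : ζ ^ (i + j + 1) ≠ 1 := by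
        intro h
        obtain ⟨c, hc⟩ := hζ.dvd_of_pow_eq_one _ h
        rcases c with _ | _ | c
        · omega
        · omega
        · rw [mul_add, mul_add] at hc
          have := Nat.zero_le (n * c)
          omega
      rw [← Finset.mul_sum, geom_sum_eq hne1, ← pow_mul, mul_comm _ n, pow_mul, hζ.pow_eq_one]
      simp
    · intro h
      exact absurd (Finset.mem_range.2 (by omega)) h
  rw [Finset.sum_congr rfl h2]
  simp
  ring

lemma sum_pow_mul_reflRatio_div_eq_zero {ζ a : ℂ} {n m : ℕ} (hζ : IsPrimitiveRoot ζ n)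
    (ha : a ^ n ≠ 1) (hm : m + 1 < n) :
    ∑ k ∈ Finset.range n, ζ ^ k * (reflRatio ζ m (ζ ^ k * a) /
      ((1 - ζ ^ k * a) * (1 - ζ ^ (-((m : ℤ) + 1)) * (ζ ^ k * a)))) = 0 := by
  have h0 : ζ ≠ 0 := hζ.ne_zero (by omega)
  have hx := one_sub_zpow_mul_ne_zero hζ.pow_eq_one ha
  have hxk (k : ℕ) (i : ℤ) : 1 - ζ ^ i * (ζ ^ k * a) ≠ 0 := by
    rw [← mul_assoc, ← zpow_natCast ζ k, ← zpow_add₀ h0]; exact hx _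
  by_cases ha0 : a = 0
  · subst ha0
    simp [reflRatio, hζ.geom_sum_eq_zero (by omega)]
  set w := ζ ^ (m + 1) with hw
  have hw0 : w ≠ 0 := pow_ne_zero _ h0
  have hw1 : w ≠ 1 := hζ.pow_ne_one_of_pos_of_lt (by omega) hm
  have e1 : ζ ^ ((m : ℤ) + 1) = w := by exact_mod_cast zpow_natCast ζ (m + 1)
  have e2 : ζ ^ (-((m : ℤ) + 1)) = w⁻¹ := by rw [zpow_neg, e1]
  let T : ℕ → ℂ := fun k =>
    reflRatio ζ m (ζ ^ k * a) * (1 - ζ ^ k * a) / (1 - w⁻¹ * (ζ ^ k * a))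
  have htel : ∑ k ∈ Finset.range n, (T (k + 1) - T k) = 0 := by
    rw [Finset.sum_range_sub]
    simp [T, hζ.pow_eq_one]
  have hterm (k : ℕ) : T (k + 1) - T k = (a * (2 - w - w⁻¹)) *
      (ζ ^ k * (reflRatio ζ m (ζ ^ k * a) /
        ((1 - ζ ^ k * a) * (1 - w⁻¹ * (ζ ^ k * a))))) := by
    have hs := reflRatio_shift h0 (hxk k) m
    have hk : 1 - ζ ^ k * a ≠ 0 := by simpa using hxk k 0
    have hk2 : 1 - w⁻¹ * (ζ ^ k * a) ≠ 0 := by rw [← e2]; exact hxk k _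
    have hk3 : 1 - ζ ^ (-(m : ℤ)) * (ζ ^ k * a) ≠ 0 := hxk k _
    have e3 : w⁻¹ * (ζ ^ (k + 1) * a) = ζ ^ (-(m : ℤ)) * (ζ ^ k * a) := by
      rw [← e2, show -(m : ℤ) = -((m : ℤ) + 1) + 1 by ring, zpow_add_one₀ h0]; ring
    have hT : T (k + 1) = reflRatio ζ m (ζ ^ k * a) * (1 - w * (ζ ^ k * a)) /
        (1 - ζ ^ k * a) := by
      simp only [T]
      rw [e3, show ζ ^ (k + 1) * a = ζ * (ζ ^ k * a) by ring, div_eq_div_iff hk3 hk]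
      rw [e1] at hs
      linear_combination hs
    have key : (1 - w * (ζ ^ k * a)) * (1 - w⁻¹ * (ζ ^ k * a)) - (1 - ζ ^ k * a) ^ 2 =
        ζ ^ k * a * (2 - w - w⁻¹) := by
      linear_combination (ζ ^ k * a) ^ 2 * mul_inv_cancel₀ hw0
    rw [hT]
    simp only [T]
    rw [div_sub_div _ _ hk hk2, mul_div_assoc', mul_div_assoc']
    congr 1
    linear_combination reflRatio ζ m (ζ ^ k * a) * key
  rw [Finset.sum_congr rfl fun k _ => hterm k, ← Finset.mul_sum] at htel
  rw [e2]
  refine (mul_eq_zero.1 htel).resolve_left (mul_ne_zero ha0 ?_)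
  intro h
  have : (w - 1) ^ 2 = 0 := by
    linear_combination (-w) * h - mul_inv_cancel₀ hw0
  exact hw1 (sub_eq_zero.1 (pow_eq_zero_iff (two_ne_zero) |>.1 this))

lemma sum_pow_mul_reflRatio_div_sq {ζ a : ℂ} {n m : ℕ} (hζ : IsPrimitiveRoot ζ n)
    (ha : a ^ n ≠ 1) (hm : m < n) :
    ∑ k ∈ Finset.range n, ζ ^ k * (reflRatio ζ m (ζ ^ k * a) / (1 - ζ ^ k * a) ^ 2) =
      (∏ j ∈ Finset.range m, -ζ ^ (j + 1)) *
        ((n : ℂ) ^ 2 * a ^ (n - 1) / (1 - a ^ n) ^ 2) := by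
  have h0 : ζ ≠ 0 := hζ.ne_zero (by omega)
  have hx := one_sub_zpow_mul_ne_zero hζ.pow_eq_one ha
  have hk (k : ℕ) : 1 - ζ ^ k * a ≠ 0 := by simpa using hx k
  induction m with
  | zero =>
    have han : 1 - a ^ n ≠ 0 := sub_ne_zero.2 (Ne.symm ha)
    rw [← sum_pow_mul_geom_sq hζ, Finset.sum_div, Finset.prod_range_zero, one_mul]
    refine Finset.sum_congr rfl fun k _ => ?_
    have hg := mul_neg_geom_sum (ζ ^ k * a) n
    rw [mul_pow, ← pow_mul, mul_comm k n, pow_mul, hζ.pow_eq_one, one_pow, one_mul] at hg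
    rw [mul_div_assoc]
    congr 1
    simp only [reflRatio, Finset.prod_range_zero]
    rw [div_eq_div_iff (pow_ne_zero _ (hk k)) (pow_ne_zero _ han), ← hg]
    ring
  | succ m ih =>
    set w := ζ ^ (m + 1) with hw
    have hw0 : w ≠ 0 := pow_ne_zero _ h0
    have e1 : ζ ^ ((m : ℤ) + 1) = w := by exact_mod_cast zpow_natCast ζ (m + 1)
    have e2 : ζ ^ (-((m : ℤ) + 1)) = w⁻¹ := by rw [zpow_neg, e1]
    have hz := sum_pow_mul_reflRatio_div_eq_zero hζ ha hm
    have hterm (k : ℕ) :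
        ζ ^ k * (reflRatio ζ (m + 1) (ζ ^ k * a) / (1 - ζ ^ k * a) ^ 2) =
        (-w) * (ζ ^ k * (reflRatio ζ m (ζ ^ k * a) / (1 - ζ ^ k * a) ^ 2)) +
        (1 + w) * (ζ ^ k * (reflRatio ζ m (ζ ^ k * a) /
          ((1 - ζ ^ k * a) * (1 - ζ ^ (-((m : ℤ) + 1)) * (ζ ^ k * a))))) := by
      have h2 : 1 - w⁻¹ * (ζ ^ k * a) ≠ 0 := by
        rw [← e2, ← mul_assoc, ← zpow_natCast ζ k, ← zpow_add₀ h0]; exact hx _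
      have key : 1 - w * (ζ ^ k * a) =
          -w * (1 - w⁻¹ * (ζ ^ k * a)) + (1 + w) * (1 - ζ ^ k * a) := by
        linear_combination (-(ζ ^ k * a)) * mul_inv_cancel₀ hw0
      rw [reflRatio_succ, e1, e2, key]
      have := hk k
      generalize 1 - w⁻¹ * (ζ ^ k * a) = u at *
      generalize 1 - ζ ^ k * a = v at *
      field_simp
    rw [Finset.sum_congr rfl fun k _ => hterm k, Finset.sum_add_distrib, ← Finset.mul_sum,
      ← Finset.mul_sum, hz, ih (by omega), Finset.prod_range_succ]
    ring

theorem stmt_8 (n : ℕ) (hn : 1 ≤ n) (ζ : ℂ) (hζ : IsPrimitiveRoot ζ n)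
    (a : ℂ) (ha : a ^ n ≠ 1) (l : ℕ) (hl1 : 1 ≤ l) (hln : l ≤ n) :
    ∑ k ∈ Finset.range n,
        (1 - a) * qPoch (ζ ^ l * a) ζ k * qPoch (ζ ^ ((1 : ℤ) - l) * a) ζ k * ζ ^ k /
          ((1 - ζ ^ k * a) * (qPoch (ζ * a) ζ k) ^ 2) =
      (n : ℂ) ^ 2 * a ^ (n - 1) / (∑ j ∈ Finset.range n, a ^ j) ^ 2 *
        (∏ j ∈ Finset.Icc 1 (l - 1), (a - ζ ^ j)) /
        ∏ j ∈ Finset.Icc 1 (l - 1), (1 - ζ ^ j * a) := by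
  obtain ⟨m, rfl⟩ : ∃ m, l = m + 1 := ⟨l - 1, by omega⟩
  have h0 : ζ ≠ 0 := hζ.ne_zero (by omega)
  have hx := one_sub_zpow_mul_ne_zero hζ.pow_eq_one ha
  have hxn (k : ℕ) : 1 - ζ ^ k * a ≠ 0 := by simpa using hx k
  have hR := reflRatio_ne_zero hx m
  have hq (k : ℕ) : qPoch (ζ * a) ζ k ≠ 0 := by
    refine Finset.prod_ne_zero_iff.2 fun j _ => ?_
    rw [show ζ * a * ζ ^ j = ζ ^ (j + 1) * a by ring]
    exact hxn _
  have hterm (k : ℕ) :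
      (1 - a) * qPoch (ζ ^ (m + 1) * a) ζ k *
          qPoch (ζ ^ ((1 : ℤ) - (m + 1 : ℕ)) * a) ζ k * ζ ^ k /
          ((1 - ζ ^ k * a) * (qPoch (ζ * a) ζ k) ^ 2) =
        (1 - a) ^ 2 / reflRatio ζ m a *
          (ζ ^ k * (reflRatio ζ m (ζ ^ k * a) / (1 - ζ ^ k * a) ^ 2)) := by
    have h := qPoch_mul_qPoch_eq h0 hx m k
    rw [show (1 : ℤ) - (m + 1 : ℕ) = -(m : ℤ) by push_cast; ring, mul_div_assoc',
      div_mul_div_comm, div_eq_div_iff (mul_ne_zero (hxn k) (pow_ne_zero _ (hq k)))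
        (mul_ne_zero hR (pow_ne_zero _ (hxn k)))]
    linear_combination (1 - a) * ζ ^ k * (1 - ζ ^ k * a) * h
  have hprod : (∏ j ∈ Finset.Icc 1 m, (a - ζ ^ j)) / ∏ j ∈ Finset.Icc 1 m, (1 - ζ ^ j * a) =
      (∏ j ∈ Finset.range m, -ζ ^ (j + 1)) / reflRatio ζ m a := by
    rw [reflRatio, ← Finset.prod_div_distrib, ← Finset.prod_div_distrib,
      ← Finset.Ico_add_one_right_eq_Icc, Finset.prod_Ico_eq_prod_range]
    refine Finset.prod_congr (by simp) fun j _ => ?_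
    have e1 : ζ ^ ((j : ℤ) + 1) = ζ ^ (j + 1) := by exact_mod_cast zpow_natCast ζ (j + 1)
    have h1 := hxn (j + 1)
    have h2 := hx (-((j : ℤ) + 1))
    have hz : ζ ^ (j + 1) ≠ 0 := pow_ne_zero _ h0
    rw [zpow_neg, e1] at h2 ⊢
    rw [add_comm 1 j, div_div_eq_mul_div]
    congr 1
    linear_combination (-a) * mul_inv_cancel₀ hz
  rw [Finset.sum_congr rfl fun k _ => hterm k, ← Finset.mul_sum,
    sum_pow_mul_reflRatio_div_sq hζ ha (by omega), Nat.add_sub_cancel,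
    mul_div_assoc _ (∏ j ∈ Finset.Icc 1 m, (a - ζ ^ j)), hprod,
    ← mul_neg_geom_sum a n]
  have h1 : 1 - a ≠ 0 := by simpa using hxn 0
  have h2 : ∑ j ∈ Finset.range n, a ^ j ≠ 0 := by
    intro h
    have := mul_neg_geom_sum a n
    rw [h, mul_zero] at this
    exact ha (sub_eq_zero.1 this.symm).symm
  field_simp
end

section
/- Let n ≥ 1 be an integer, let ζ ∈ ℂ be a primitive nth root of unity, and let a ∈ ℂ with a^n ≠ 1. Then ∑_{k=0}^{n-1} ζ^k/(1-ζ^k a)² = n² a^{n-1}/(1-a^n)². -/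
open Finset

lemma one_sub_pow_mul_ne_zero {K : Type*} [CommRing K] {n : ℕ} {ζ x : K} (hζ : ζ ^ n = 1)
    (hx : x ^ n ≠ 1) (k : ℕ) : 1 - ζ ^ k * x ≠ 0 := by
  intro h
  apply hx
  have h1 : (ζ ^ k * x) ^ n = 1 := by rw [← sub_eq_zero.mp h, one_pow]
  rwa [mul_pow, ← pow_mul, mul_comm k, pow_mul, hζ, one_pow, one_mul] at h1

lemma IsPrimitiveRoot.sum_pow_mul_eq_zero {R : Type*} [CommRing R] [IsDomain R] {n j : ℕ} {ζ : R}
    (hζ : IsPrimitiveRoot ζ n) (hj : j ≠ 0) (hjn : j < n) :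
    ∑ k ∈ range n, (ζ ^ k) ^ j = 0 := by
  have h := mul_neg_geom_sum (ζ ^ j) n
  rw [← pow_mul, mul_comm j, pow_mul, hζ.pow_eq_one, one_pow, sub_self] at h
  have hne : 1 - ζ ^ j ≠ 0 := sub_ne_zero.mpr (hζ.pow_ne_one_of_pos_of_lt hj hjn).symm
  simpa only [← pow_mul, mul_comm j] using (mul_eq_zero.mp h).resolve_left hne

/-- Partial fraction decomposition of `n / (1 - x ^ n)`. -/
lemma IsPrimitiveRoot.sum_inv_one_sub_pow_mul {K : Type*} [Field K] {n : ℕ} (hn : 1 ≤ n) {ζ x : K}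
    (hζ : IsPrimitiveRoot ζ n) (hx : x ^ n ≠ 1) :
    ∑ k ∈ range n, (1 - ζ ^ k * x)⁻¹ = n * (1 - x ^ n)⁻¹ := by
  have hx' : 1 - x ^ n ≠ 0 := sub_ne_zero.mpr hx.symm
  have hterm (k : ℕ) :
      (1 - ζ ^ k * x)⁻¹ = (∑ j ∈ range n, (ζ ^ k) ^ j * x ^ j) * (1 - x ^ n)⁻¹ := by
    have hk := one_sub_pow_mul_ne_zero hζ.pow_eq_one hx k
    have h := mul_neg_geom_sum (ζ ^ k * x) n
    rw [mul_pow, ← pow_mul, mul_comm k, pow_mul, hζ.pow_eq_one, one_pow, one_mul] at h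
    simp only [mul_pow] at h
    rw [inv_eq_iff_eq_inv, mul_inv, inv_inv, ← h]
    have hs : ∑ j ∈ range n, (ζ ^ k) ^ j * x ^ j ≠ 0 := fun h0 ↦ hx' (by rw [← h, h0, mul_zero])
    field_simp
  simp only [hterm]
  rw [← sum_mul, sum_comm]
  simp only [← sum_mul]
  rw [sum_eq_single_of_mem 0 (mem_range.mpr hn)]
  · simp
  · intro j hj hj0
    rw [hζ.sum_pow_mul_eq_zero hj0 (mem_range.mp hj), zero_mul]

theorem stmt_9 (n : ℕ) (hn : 1 ≤ n) (ζ : ℂ) (hζ : IsPrimitiveRoot ζ n)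
    (a : ℂ) (ha : a ^ n ≠ 1) :
    ∑ k ∈ Finset.range n, ζ ^ k / (1 - ζ ^ k * a) ^ 2 =
      (n : ℂ) ^ 2 * a ^ (n - 1) / (1 - a ^ n) ^ 2 := by
  have hleft : HasDerivAt (fun x : ℂ ↦ ∑ k ∈ range n, (1 - ζ ^ k * x)⁻¹)
      (∑ k ∈ range n, ζ ^ k / (1 - ζ ^ k * a) ^ 2) a := by
    refine HasDerivAt.fun_sum fun k _ ↦ ?_
    have h := (((hasDerivAt_id a).const_mul (ζ ^ k)).const_sub 1).fun_inv
      (one_sub_pow_mul_ne_zero hζ.pow_eq_one ha k)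
    simpa using h
  have hright : HasDerivAt (fun x : ℂ ↦ (n : ℂ) * (1 - x ^ n)⁻¹)
      ((n : ℂ) ^ 2 * a ^ (n - 1) / (1 - a ^ n) ^ 2) a := by
    have h := (((hasDerivAt_pow n a).const_sub 1).fun_inv
      (sub_ne_zero.mpr ha.symm)).const_mul (n : ℂ)
    refine h.congr_deriv ?_
    ring
  have hev : (fun x : ℂ ↦ ∑ k ∈ range n, (1 - ζ ^ k * x)⁻¹) =ᶠ[nhds a]
      fun x ↦ (n : ℂ) * (1 - x ^ n)⁻¹ := by
    filter_upwards [(continuous_pow n).continuousAt.eventually_ne ha] with x hx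
    exact hζ.sum_inv_one_sub_pow_mul hn hx
  exact hleft.unique (hright.congr_of_eventuallyEq hev)
end
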